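/- There is no function Φ : (ℕ → ℕ → Bool) → (ℕ → Bool) × (ℕ → ℕ) × (ℕ → ℕ) such that, writing Φ R = (C, b, ξ): (i) for every R and every k, ξ k > k and C (ξ k) = true (so C is an infinite set with ξ witnessing its infinitude); (ii) for every R and every i, either R i n = true for every n with C n = true and n ≥ b i, or R i n = false for every n with C n = true and n ≥ b i (so C is cohesive for the family (R i) with bound witness b); and (iii) Φ is continuous at the constant-true family. (This is the set-theoretic content of the paper's Theorem that the uniform cohesive set principle UCOH is equivalent to arithmetical comprehension.) -/

import Mathlib

/-- There is no uniform COH-functional (with witnesses for infinitude and for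
cohesiveness) that is continuous at the constant-true family. -/
theorem no_continuous_uniform_COH :
    ¬ ∃ Φ : (ℕ → ℕ → Bool) → (ℕ → Bool) × (ℕ → ℕ) × (ℕ → ℕ),
      (∀ R : ℕ → ℕ → Bool, ∀ k, (Φ R).2.2 k > k ∧ (Φ R).1 ((Φ R).2.2 k) = true) ∧
      (∀ R : ℕ → ℕ → Bool, ∀ i,
        (∀ n, (Φ R).1 n = true → (Φ R).2.1 i ≤ n → R i n = true) ∨
        (∀ n, (Φ R).1 n = true → (Φ R).2.1 i ≤ n → R i n = false)) ∧
      ContinuousAt Φ (fun _ _ => true) := by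
  rintro ⟨Φ, hξ, hcoh, hcont⟩
  -- The truncated families `n < m` converge to the constant-true family.
  have hlim : Filter.Tendsto (fun m : ℕ => fun _ n : ℕ => decide (n < m)) Filter.atTop
      (nhds fun _ _ : ℕ => true) := by
    simp only [tendsto_pi_nhds]
    intro _ n
    refine tendsto_const_nhds.congr' ?_
    filter_upwards [Filter.eventually_gt_atTop n] with m hm
    simp [hm]
  have hΦ := hcont.tendsto.comp hlim
  generalize Φ (fun _ _ => true) = p at hΦ
  have hb := (tendsto_pi_nhds.1 hΦ.snd_nhds.fst_nhds 0)
  have hx := (tendsto_pi_nhds.1 hΦ.snd_nhds.snd_nhds (p.2.1 0))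
  rw [nhds_discrete, Filter.tendsto_pure] at hb hx
  obtain ⟨m, hbm, hxm, hm⟩ :=
    (hb.and (hx.and (Filter.eventually_gt_atTop (p.2.2 (p.2.1 0))))).exists
  simp only [Function.comp_apply] at hbm hxm
  set R : ℕ → ℕ → Bool := fun _ n => decide (n < m)
  obtain ⟨hgt, hmem⟩ := hξ R (p.2.1 0)
  obtain ⟨hgt', hmem'⟩ := hξ R (max m (p.2.1 0))
  rcases hcoh R 0 with h | h
  · have := of_decide_eq_true (h _ hmem' (by omega))
    omega
  · have := of_decide_eq_false (h _ hmem (by omega))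
    omega
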